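/- Fix a natural number n and let J ⊆ {0,…,n−1} with complement J^c = {0,…,n−1}∖J. Let j ∈ J^c, let I be a set with J^c ⊆ I ⊆ {0,…,n−1}, and set K = J ∪ {j}, so that the complement K^c of K in {0,…,n−1} equals J^c∖{j}. Then σ({j},J) · σ(J^c,J) · σ(I∖J^c, J^c) = σ(K^c,K) · σ(I∖{j},{j}) · σ((I∖{j})∖K^c, K^c). (This is Equation (59), the signature condition verified in the paper's proof of the Stokes theorem for the flux, Theorem 2.) -/

import Mathlib

/-- Number of "inversion" pairs (a,b) ∈ A × B with b < a. -/
def invCount (A B : Finset ℕ) : ℕ :=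
  ((A ×ˢ B).filter (fun p => p.2 < p.1)).card

/-- The signature σ(A,B) = (−1)^{N(A,B)} of the permutation sorting the
concatenation of the increasing enumerations of A and B. -/
def sortSign (A B : Finset ℕ) : ℤ :=
  (-1) ^ invCount A B

theorem sortSign_union_left {A B : Finset ℕ} (h : Disjoint A B) (C : Finset ℕ) :
    sortSign (A ∪ B) C = sortSign A C * sortSign B C := by
  rw [sortSign, sortSign, sortSign, ← pow_add, invCount, Finset.union_product,
    Finset.filter_union, Finset.card_union_of_disjoint]
  · rfl
  · exact Finset.disjoint_filter_filter (Finset.disjoint_product.2 (Or.inl h))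

theorem sortSign_union_right (A : Finset ℕ) {B C : Finset ℕ} (h : Disjoint B C) :
    sortSign A (B ∪ C) = sortSign A B * sortSign A C := by
  rw [sortSign, sortSign, sortSign, ← pow_add, invCount, Finset.product_union,
    Finset.filter_union, Finset.card_union_of_disjoint]
  · rfl
  · exact Finset.disjoint_filter_filter (Finset.disjoint_product.2 (Or.inr h))

theorem sortSign_mul_self (A B : Finset ℕ) : sortSign A B * sortSign A B = 1 := by
  rw [sortSign, ← mul_pow]
  simp

theorem flux_stokes_signature_condition (n : ℕ) (J I : Finset ℕ) (j : ℕ)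
    (hJ : J ⊆ Finset.range n)
    (hj : j ∈ Finset.range n \ J)
    (hJcI : Finset.range n \ J ⊆ I) (hI : I ⊆ Finset.range n) :
    sortSign {j} J * sortSign (Finset.range n \ J) J *
        sortSign (I \ (Finset.range n \ J)) (Finset.range n \ J) =
      sortSign (Finset.range n \ (J ∪ {j})) (J ∪ {j}) *
        sortSign (I \ {j}) {j} *
        sortSign ((I \ {j}) \ (Finset.range n \ (J ∪ {j})))
          (Finset.range n \ (J ∪ {j})) := by
  set P := Finset.range n \ J with hP
  have hQ : Finset.range n \ (J ∪ {j}) = P \ {j} := by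
    rw [hP, sdiff_sdiff_left, Finset.sup_eq_union]
  rw [hQ]
  have hjJ : j ∉ J := (Finset.mem_sdiff.1 hj).2
  have hjI : j ∈ I := hJcI hj
  have hPQ : P = P \ {j} ∪ {j} :=
    (Finset.sdiff_union_of_subset (Finset.singleton_subset_iff.2 hj)).symm
  have hQj : Disjoint (P \ {j}) {j} := Finset.sdiff_disjoint
  have hL : (I \ {j}) \ (P \ {j}) = I \ P := by
    ext x
    simp only [Finset.mem_sdiff, Finset.mem_singleton]
    grind
  have hIj : I \ {j} = I \ P ∪ P \ {j} := by
    ext x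
    simp only [Finset.mem_sdiff, Finset.mem_singleton, Finset.mem_union]
    grind
  have hLQ : Disjoint (I \ P) (P \ {j}) :=
    Finset.sdiff_disjoint.mono_right Finset.sdiff_subset
  have hPJ : sortSign P J = sortSign (P \ {j}) J * sortSign {j} J := by
    rw [← sortSign_union_left hQj, ← hPQ]
  have hLP : sortSign (I \ P) P = sortSign (I \ P) (P \ {j}) * sortSign (I \ P) {j} := by
    rw [← sortSign_union_right _ hQj, ← hPQ]
  rw [hL, hIj, sortSign_union_left hLQ, hPJ, hLP,
    sortSign_union_right _ (Finset.disjoint_singleton_right.2 hjJ)]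
  linear_combination
    sortSign (P \ {j}) J * sortSign (I \ P) (P \ {j}) * sortSign (I \ P) {j} *
      (sortSign_mul_self {j} J - sortSign_mul_self (P \ {j}) {j})
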